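/- arXiv:math/0409477 — 3 statements merged into one kernel-verified Lean document; each statement's English description precedes it below -/
import Mathlib

section
/- A totally regular Q-semicategory B is Cauchy complete if and only if, for every idempotent arrow e in Q, every Cauchy (i.e. left adjoint in TRSDist(Q)) regular semidistributor φ : *_e ⇸ B converges. -/
open CategoryTheory

universe u

variable (Q : Type u) [SmallCategory Q] [∀ X Y : Q, CompleteLattice (X ⟶ Y)]

/-- A (small) quantaloid: a category whose hom-sets are complete lattices and in which
composition distributes on both sides over arbitrary suprema. -/
class IsQuantaloid : Prop where
  comp_sSup : ∀ {X Y Z : Q} (f : X ⟶ Y) (S : Set (Y ⟶ Z)),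
      f ≫ sSup S = ⨆ g ∈ S, f ≫ g
  sSup_comp : ∀ {X Y Z : Q} (S : Set (X ⟶ Y)) (g : Y ⟶ Z),
      sSup S ≫ g = ⨆ f ∈ S, f ≫ g

/-- A `Q`-typed set together with a matrix of hom-arrows.  `A.hom a a' : A.ty a ⟶ A.ty a'`
is the hom-arrow written `A(a',a) : ta → ta'` in the paper. -/
structure QGraph where
  Obj : Type u
  ty : Obj → Q
  hom : ∀ a a' : Obj, ty a ⟶ ty a'

variable {Q}

namespace QGraph

/-- `Q`-semicategory: composition inequality. -/
def IsSemiCat (A : QGraph Q) : Prop :=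
  ∀ a a' a'' : A.Obj, A.hom a a' ≫ A.hom a' a'' ≤ A.hom a a''

/-- Regular `Q`-semicategory. -/
def IsRegular (A : QGraph Q) : Prop :=
  A.IsSemiCat ∧ ∀ a a'' : A.Obj, (⨆ a' : A.Obj, A.hom a a' ≫ A.hom a' a'') = A.hom a a''

/-- Totally regular `Q`-semicategory (elementary characterization):
`A(a,a)∘A(a,a') = A(a,a')` and `A(a',a)∘A(a,a) = A(a',a)`. -/
def IsTR (A : QGraph Q) : Prop :=
  A.IsSemiCat ∧ (∀ a a' : A.Obj, A.hom a a ≫ A.hom a a' = A.hom a a')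
    ∧ (∀ a a' : A.Obj, A.hom a' a ≫ A.hom a a = A.hom a' a)

/-- `Q`-category: composition inequality plus unit inequality. -/
def IsCat (A : QGraph Q) : Prop :=
  A.IsSemiCat ∧ ∀ a : A.Obj, 𝟙 (A.ty a) ≤ A.hom a a

/-- Normal `Q`-category: all endo-hom-arrows are identities. -/
def IsNormal (A : QGraph Q) : Prop :=
  ∀ a : A.Obj, A.hom a a = 𝟙 (A.ty a)

/-- The one-object structure `*_e` on an arrow `e : X ⟶ X`. -/
def single (X : Q) (e : X ⟶ X) : QGraph Q :=
  ⟨PUnit, fun _ => X, fun _ _ => e⟩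

/-- Full subgraph determined by a subset of the objects. -/
def restrict (A : QGraph Q) (s : Set A.Obj) : QGraph Q :=
  ⟨s, fun x => A.ty x, fun x y => A.hom x y⟩

end QGraph

/-- A matrix of `Q`-arrows: `Φ a b : ty a ⟶ ty b` is the paper's `Φ(b,a) : ta → tb`. -/
def QMat (A B : QGraph Q) : Type u :=
  ∀ (a : A.Obj) (b : B.Obj), A.ty a ⟶ B.ty b

/-- Composition of matrices: `(Ψ⊗Φ)(c,a) = ⋁_b Ψ(c,b)∘Φ(b,a)`. -/
def matComp {A B C : QGraph Q} (Φ : QMat A B) (Ψ : QMat B C) : QMat A C :=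
  fun a c => ⨆ b, Φ a b ≫ Ψ b c

/-- (Plain) distributor between `Q`-categories. -/
def IsDist {A B : QGraph Q} (Φ : QMat A B) : Prop :=
  (∀ (a : A.Obj) (b b' : B.Obj), Φ a b ≫ B.hom b b' ≤ Φ a b') ∧
  (∀ (a' a : A.Obj) (b : B.Obj), A.hom a' a ≫ Φ a b ≤ Φ a' b)

/-- Regular semidistributor. -/
def IsRSDist {A B : QGraph Q} (Φ : QMat A B) : Prop :=
  (∀ (a : A.Obj) (b' : B.Obj), (⨆ b, Φ a b ≫ B.hom b b') = Φ a b') ∧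
  (∀ (a' : A.Obj) (b : B.Obj), (⨆ a, A.hom a' a ≫ Φ a b) = Φ a' b)

/-- Adjunction `Φ ⊣ Ψ` (unit and counit inequalities) between matrices. -/
def MatAdj {A B : QGraph Q} (Φ : QMat A B) (Ψ : QMat B A) : Prop :=
  (∀ a a', A.hom a a' ≤ matComp Φ Ψ a a') ∧
  (∀ b b', matComp Ψ Φ b b' ≤ B.hom b b')

/-- A type-preserving object map. -/
structure ObjMap (A B : QGraph Q) where
  map : A.Obj → B.Obj
  ty_eq : ∀ a, B.ty (map a) = A.ty a

namespace ObjMap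

variable {A B C : QGraph Q}

/-- The matrix `B(-,F-)` induced by an object map. -/
def graph (F : ObjMap A B) : QMat A B :=
  fun a b => eqToHom (F.ty_eq a).symm ≫ B.hom (F.map a) b

/-- The matrix `B(F-,-)` induced by an object map. -/
def cograph (F : ObjMap A B) : QMat B A :=
  fun b a => B.hom b (F.map a) ≫ eqToHom (F.ty_eq a)

/-- Semifunctor: `A(a',a) ≤ B(Fa',Fa)`. -/
def IsSemiFun (F : ObjMap A B) : Prop :=
  ∀ a a', A.hom a a' ≤
    eqToHom (F.ty_eq a).symm ≫ B.hom (F.map a) (F.map a') ≫ eqToHom (F.ty_eq a')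

/-- Fully faithful semifunctor: `A(a',a) = B(Fa',Fa)`. -/
def IsFullyFaithful (F : ObjMap A B) : Prop :=
  ∀ a a', A.hom a a' =
    eqToHom (F.ty_eq a).symm ≫ B.hom (F.map a) (F.map a') ≫ eqToHom (F.ty_eq a')

/-- Regular semifunctor: a semifunctor such that `⋁_{a'} B(b,Fa')∘A(a',a) = B(b,Fa)` and
`⋁_{a'} A(a,a')∘B(Fa',b) = B(Fa,b)`. -/
def IsRSFun (F : ObjMap A B) : Prop :=
  F.IsSemiFun ∧
  (∀ a b, (⨆ a', A.hom a a' ≫ F.graph a' b) = F.graph a b) ∧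
  (∀ a b, (⨆ a', F.cograph b a' ≫ A.hom a' a) = F.cograph b a)

/-- Composition of object maps (`G ∘ F`). -/
def comp (F : ObjMap A B) (G : ObjMap B C) : ObjMap A C :=
  ⟨fun a => G.map (F.map a), fun a => (G.ty_eq (F.map a)).trans (F.ty_eq a)⟩

end ObjMap

/-- A left adjoint matrix `Φ` (with right adjoint `Ψ`) converges when it is induced by a
regular semifunctor, i.e. `Φ = B(-,F-)` and `Ψ = B(F-,-)`. -/
def Converges {A B : QGraph Q} (Φ : QMat A B) (Ψ : QMat B A) : Prop :=
  ∃ F : ObjMap A B, F.IsRSFun ∧ (∀ a b, Φ a b = F.graph a b) ∧ (∀ b a, Ψ b a = F.cograph b a)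

/-- Cauchy completeness of a totally regular `Q`-semicategory:
every Cauchy (left adjoint) regular semidistributor into it converges. -/
def CauchyComplete (B : QGraph Q) : Prop :=
  ∀ (A : QGraph Q), A.IsTR → ∀ (Φ : QMat A B) (Ψ : QMat B A),
    IsRSDist Φ → IsRSDist Ψ → MatAdj Φ Ψ → Converges Φ Ψ

/-- Cauchy completeness of a `Q`-category: every left adjoint distributor into it
is induced by a functor. -/
def CatCauchyComplete (B : QGraph Q) : Prop :=
  ∀ (A : QGraph Q), A.IsCat → ∀ (Φ : QMat A B) (Ψ : QMat B A),
    IsDist Φ → IsDist Ψ → MatAdj Φ Ψ →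
    ∃ F : ObjMap A B, F.IsSemiFun ∧ ∀ a b, Φ a b = F.graph a b

/-- An object `a` of a regular `Q`-semicategory is stable when it is the value of a regular
semifunctor on a one-object regular `Q`-semicategory `*_e` (`e` an idempotent). -/
def QGraph.Stable (A : QGraph Q) (a : A.Obj) : Prop :=
  ∃ (X : Q) (e : X ⟶ X), e ≫ e = e ∧
    ∃ F : ObjMap (QGraph.single X e) A, F.IsRSFun ∧ F.map PUnit.unit = a

theorem comp_iSup_quantaloid [IsQuantaloid Q] {X Y Z : Q} {ι : Type*} (f : X ⟶ Y)
    (g : ι → (Y ⟶ Z)) : f ≫ (⨆ i, g i) = ⨆ i, f ≫ g i := by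
  rw [iSup, IsQuantaloid.comp_sSup, iSup_range]

theorem iSup_comp_quantaloid [IsQuantaloid Q] {X Y Z : Q} {ι : Type*} (f : ι → (X ⟶ Y))
    (g : Y ⟶ Z) : (⨆ i, f i) ≫ g = ⨆ i, f i ≫ g := by
  rw [iSup, IsQuantaloid.sSup_comp, iSup_range]

theorem comp_le_comp_left_quantaloid [IsQuantaloid Q] {X Y Z : Q} (f : X ⟶ Y) {g h : Y ⟶ Z}
    (hgh : g ≤ h) : f ≫ g ≤ f ≫ h := by
  have key := IsQuantaloid.comp_sSup f {g, h}
  rw [sSup_pair, sup_eq_right.mpr hgh] at key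
  rw [key]
  exact le_iSup₂_of_le g (Set.mem_insert g {h}) le_rfl

theorem comp_le_comp_right_quantaloid [IsQuantaloid Q] {X Y Z : Q} {f g : X ⟶ Y} (hfg : f ≤ g)
    (h : Y ⟶ Z) : f ≫ h ≤ g ≫ h := by
  have key := IsQuantaloid.sSup_comp {f, g} h
  rw [sSup_pair, sup_eq_right.mpr hfg] at key
  rw [key]
  exact le_iSup₂_of_le f (Set.mem_insert f {g}) le_rfl

theorem QGraph.isTR_single {X : Q} {e : X ⟶ X} (he : e ≫ e = e) : (QGraph.single X e).IsTR :=
  ⟨fun _ _ _ => he.le, fun _ _ => he, fun _ _ => he⟩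

theorem MatAdj.row_col {A B : QGraph Q} {Φ : QMat A B} {Ψ : QMat B A} (h : MatAdj Φ Ψ) (a : A.Obj) :
    MatAdj (A := QGraph.single (A.ty a) (A.hom a a)) (B := B)
      (fun _ b => Φ a b) (fun b _ => Ψ b a) :=
  ⟨fun _ _ => h.1 a a, fun b b' => iSup_le fun _ =>
    (le_iSup (fun a => Ψ b a ≫ Φ a b') a).trans (h.2 b b')⟩

section Regular

variable [IsQuantaloid Q] {A B : QGraph Q}

theorem IsRSDist.hom_self_comp {Φ : QMat A B} (hΦ : IsRSDist Φ) (hA : A.IsTR)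
    (a : A.Obj) (b : B.Obj) : A.hom a a ≫ Φ a b = Φ a b := by
  rw [← hΦ.2 a b, comp_iSup_quantaloid]
  simp_rw [← Category.assoc, hA.2.1]

theorem IsRSDist.comp_hom_self {Ψ : QMat B A} (hΨ : IsRSDist Ψ) (hA : A.IsTR)
    (b : B.Obj) (a : A.Obj) : Ψ b a ≫ A.hom a a = Ψ b a := by
  rw [← hΨ.1 b a, iSup_comp_quantaloid]
  simp_rw [Category.assoc, hA.2.2]

/-- The row of a regular semidistributor at an object `a`, with domain `*_{A(a,a)}`. -/
theorem IsRSDist.row {Φ : QMat A B} (hΦ : IsRSDist Φ) (hA : A.IsTR) (a : A.Obj) :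
    IsRSDist (A := QGraph.single (A.ty a) (A.hom a a)) (B := B) (fun _ b => Φ a b) :=
  ⟨fun _ b => hΦ.1 a b, fun _ b =>
    (iSup_const (ι := PUnit.{u + 1})).trans (hΦ.hom_self_comp hA a b)⟩

/-- The column of a regular semidistributor at an object `a`, with codomain `*_{A(a,a)}`. -/
theorem IsRSDist.col {Ψ : QMat B A} (hΨ : IsRSDist Ψ) (hA : A.IsTR) (a : A.Obj) :
    IsRSDist (A := B) (B := QGraph.single (A.ty a) (A.hom a a)) (fun b _ => Ψ b a) :=
  ⟨fun b _ => (iSup_const (ι := PUnit.{u + 1})).trans (hΨ.comp_hom_self hA b a),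
    fun b _ => hΨ.2 b a⟩

/-- An object map inducing both halves of an adjunction of regular semidistributors is a
regular semifunctor. -/
theorem ObjMap.isRSFun_of_adj (F : ObjMap A B) (hB : B.IsSemiCat)
    (hΦ : IsRSDist F.graph) (hΨ : IsRSDist F.cograph) (h : MatAdj F.graph F.cograph) :
    F.IsRSFun := by
  refine ⟨fun a a' => (h.1 a a').trans (iSup_le fun b => ?_), hΦ.2, fun a b => hΨ.1 b a⟩
  simp only [ObjMap.graph, ObjMap.cograph, Category.assoc]
  refine comp_le_comp_left_quantaloid _ ?_
  rw [← Category.assoc]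
  exact comp_le_comp_right_quantaloid (hB _ _ _) _

end Regular

/-- a totally regular `Q`-semicategory is Cauchy complete iff every Cauchy
regular semidistributor `φ : *_e ⇸ B`, for `e` an idempotent of `Q`, converges. -/
theorem cauchyComplete_iff_one_object_converge [IsQuantaloid Q]
    (B : QGraph Q) (hB : B.IsTR) :
    CauchyComplete B ↔
      ∀ (X : Q) (e : X ⟶ X), e ≫ e = e →
        ∀ (Φ : QMat (QGraph.single X e) B) (Ψ : QMat B (QGraph.single X e)),
          IsRSDist Φ → IsRSDist Ψ → MatAdj Φ Ψ → Converges Φ Ψ := by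
  constructor
  · intro hC X e he Φ Ψ
    exact hC _ (QGraph.isTR_single he) Φ Ψ
  · intro hone A hA Φ Ψ hΦ hΨ hadj
    have hpt : ∀ a : A.Obj, ∃ (b₀ : B.Obj) (ht : B.ty b₀ = A.ty a),
        (∀ b, Φ a b = eqToHom ht.symm ≫ B.hom b₀ b) ∧
          ∀ b, Ψ b a = B.hom b b₀ ≫ eqToHom ht := by
      intro a
      obtain ⟨F, -, hg, hc⟩ := hone (A.ty a) (A.hom a a) (hA.2.1 a a) _ _
        (hΦ.row hA a) (hΨ.col hA a) (hadj.row_col a)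
      exact ⟨F.map PUnit.unit, F.ty_eq PUnit.unit, fun b => hg PUnit.unit b,
        fun b => hc b PUnit.unit⟩
    choose f ht hg hc using hpt
    let F : ObjMap A B := ⟨f, ht⟩
    obtain rfl : Φ = F.graph := funext₂ hg
    obtain rfl : Ψ = F.cograph := funext₂ fun b a => hc a b
    exact ⟨F, F.isRSFun_of_adj hB.1 hΦ hΨ hadj, fun _ _ => rfl, fun _ _ => rfl⟩
end

section
/- For any totally regular Q-semicategory B, the regular semidistributors B_cc(-,k_B-) : B ⇸ B_cc and B_cc(k_B-,-) : B_cc ⇸ B are each other's inverse in the quantaloid TRSDist(Q); in particular B ≅ B_cc in TRSDist(Q). -/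
open CategoryTheory

universe u

variable (Q : Type u) [SmallCategory Q] [∀ X Y : Q, CompleteLattice (X ⟶ Y)]

variable {Q}

/-- An object of the Cauchy completion of `B`: a left adjoint regular semidistributor
`φ : *_e ⇸ B` (for an idempotent `e : X ⟶ X` of `Q`) together with its right adjoint `ψ`. -/
structure CCObj (B : QGraph Q) where
  X : Q
  e : X ⟶ X
  idem : e ≫ e = e
  φ : ∀ b : B.Obj, X ⟶ B.ty b
  ψ : ∀ b : B.Obj, B.ty b ⟶ X
  φ_regl : ∀ b', (⨆ b, φ b ≫ B.hom b b') = φ b'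
  φ_regr : ∀ b, e ≫ φ b = φ b
  ψ_regl : ∀ b, ψ b ≫ e = ψ b
  ψ_regr : ∀ b', (⨆ b, B.hom b' b ≫ ψ b) = ψ b'
  unit : e ≤ ⨆ b, φ b ≫ ψ b
  counit : ∀ b b', ψ b ≫ φ b' ≤ B.hom b b'

/-- The Cauchy completion `B_cc`; its hom-arrow from `p` to `q` is `B_cc(q,p) = q* ⊗ p`,
i.e. the lifting `[q,p]` in `TRSDist(Q)`. -/
def QGraph.cc (B : QGraph Q) : QGraph Q :=
  ⟨CCObj B, fun p => p.X, fun p q => ⨆ b, p.φ b ≫ q.ψ b⟩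

/-- The object `k_B b`, i.e. the left adjoint `B(-,b) : *_{B(b,b)} ⇸ B` with right
adjoint `B(b,-)`. -/
def kObj {B : QGraph Q} (hB : B.IsTR) (b : B.Obj) : CCObj B where
  X := B.ty b
  e := B.hom b b
  idem := hB.2.1 b b
  φ := fun y => B.hom b y
  ψ := fun y => B.hom y b
  φ_regl := fun b' =>
    le_antisymm (iSup_le fun y => hB.1 b y b') (le_iSup_of_le b (hB.2.1 b b').ge)
  φ_regr := fun y => hB.2.1 b y
  ψ_regl := fun y => hB.2.2 b y
  ψ_regr := fun b' =>
    le_antisymm (iSup_le fun y => hB.1 b' y b) (le_iSup_of_le b (hB.2.2 b b').ge)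
  unit := le_iSup_of_le b (hB.2.1 b b).ge
  counit := fun y y' => hB.1 y b y'

/-- The Cauchy completion embedding `k_B : B → B_cc`. -/
def kMap {B : QGraph Q} (hB : B.IsTR) : ObjMap B (QGraph.cc B) :=
  ⟨fun b => kObj hB b, fun _ => rfl⟩

namespace IsQuantaloid

variable [IsQuantaloid Q] {X Y Z : Q}

theorem comp_iSup {ι : Type*} (f : X ⟶ Y) (g : ι → (Y ⟶ Z)) :
    f ≫ (⨆ i, g i) = ⨆ i, f ≫ g i := by
  rw [iSup, comp_sSup, iSup_range]

theorem iSup_comp {ι : Type*} (f : ι → (X ⟶ Y)) (g : Y ⟶ Z) :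
    (⨆ i, f i) ≫ g = ⨆ i, f i ≫ g := by
  rw [iSup, sSup_comp, iSup_range]

theorem comp_le_comp_left (f : X ⟶ Y) {g g' : Y ⟶ Z} (h : g ≤ g') : f ≫ g ≤ f ≫ g' := by
  rw [← sup_eq_right, ← sSup_pair] at h
  rw [← h, comp_sSup]
  exact le_iSup₂_of_le g (Set.mem_insert _ _) le_rfl

theorem comp_le_comp_right {f f' : X ⟶ Y} (h : f ≤ f') (g : Y ⟶ Z) : f ≫ g ≤ f' ≫ g := by
  rw [← sup_eq_right, ← sSup_pair] at h
  rw [← h, sSup_comp]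
  exact le_iSup₂_of_le f (Set.mem_insert _ _) le_rfl

end IsQuantaloid

namespace QGraph

variable {B : QGraph Q}

theorem cc_hom_kObj_left (hB : B.IsTR) (b : B.Obj) (p : CCObj B) :
    (cc B).hom (kObj hB b) p = p.ψ b :=
  p.ψ_regr b

theorem cc_hom_kObj_right (hB : B.IsTR) (p : CCObj B) (b : B.Obj) :
    (cc B).hom p (kObj hB b) = p.φ b :=
  p.φ_regl b

end QGraph

namespace CCObj

open IsQuantaloid

variable {B : QGraph Q}

theorem iSup_ψ_comp_φ (hB : B.IsTR) (b b' : B.Obj) :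
    (⨆ p : CCObj B, p.ψ b ≫ p.φ b') = B.hom b b' :=
  le_antisymm (iSup_le fun p => p.counit b b')
    (le_iSup_of_le (kObj hB b) (hB.2.1 b b').ge)

variable [IsQuantaloid Q]

theorem iSup_ψ_comp_cc_hom (q : CCObj B) (b : B.Obj) :
    (⨆ p : CCObj B, p.ψ b ≫ (⨆ y, p.φ y ≫ q.ψ y)) = q.ψ b := by
  apply le_antisymm
  · refine iSup_le fun p => ?_
    rw [comp_iSup]
    conv_rhs => rw [← q.ψ_regr b]
    refine iSup_mono fun y => ?_
    rw [← Category.assoc]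
    exact comp_le_comp_right (p.counit b y) _
  · refine le_iSup_of_le q ?_
    conv_lhs => rw [← q.ψ_regl b]
    exact comp_le_comp_left _ q.unit

theorem iSup_cc_hom_comp_φ (p : CCObj B) (b : B.Obj) :
    (⨆ q : CCObj B, (⨆ y, p.φ y ≫ q.ψ y) ≫ q.φ b) = p.φ b := by
  apply le_antisymm
  · refine iSup_le fun q => ?_
    rw [iSup_comp]
    conv_rhs => rw [← p.φ_regl b]
    refine iSup_mono fun y => ?_
    rw [Category.assoc]
    exact comp_le_comp_left _ (q.counit y b)
  · refine le_iSup_of_le p ?_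
    conv_lhs => rw [← p.φ_regr b]
    exact comp_le_comp_right p.unit _

end CCObj

/-- the regular semidistributors `B_cc(-,k_B-) : B ⇸ B_cc` and
`B_cc(k_B-,-) : B_cc ⇸ B` are each other's inverse in `TRSDist(Q)`; in particular
`B ≅ B_cc` in `TRSDist(Q)`. -/
theorem cc_inverse_pair [IsQuantaloid Q] (B : QGraph Q) (hB : B.IsTR) :
    let Φ : QMat B (QGraph.cc B) := fun b p => (QGraph.cc B).hom (kObj hB b) p
    let Ψ : QMat (QGraph.cc B) B := fun p b => (QGraph.cc B).hom p (kObj hB b)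
    IsRSDist Φ ∧ IsRSDist Ψ ∧
      (∀ b b', matComp Φ Ψ b b' = B.hom b b') ∧
      (∀ p q, matComp Ψ Φ p q = (QGraph.cc B).hom p q) := by
  intro Φ Ψ
  have hΦ : Φ = fun b p => p.ψ b :=
    funext fun b => funext fun p => QGraph.cc_hom_kObj_left hB b p
  have hΨ : Ψ = fun p b => p.φ b :=
    funext fun p => funext fun b => QGraph.cc_hom_kObj_right hB p b
  rw [hΦ, hΨ]
  exact ⟨⟨fun b q => q.iSup_ψ_comp_cc_hom b, fun b p => p.ψ_regr b⟩,
    ⟨fun p b => p.φ_regl b, fun p b => p.iSup_cc_hom_comp_φ b⟩,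
    CCObj.iSup_ψ_comp_φ hB, fun _ _ => rfl⟩
end

section
/- Let A and B be totally regular Q-semicategories with B Cauchy complete. Any regular semifunctor F : A → B factors through the Cauchy completion k_A : A → A_cc in an essentially unique way: there exists a regular semifunctor G : A_cc → B with B(-,G∘k_A-) = B(-,F-), and any other regular semifunctor H : A_cc → B with B(-,H∘k_A-) = B(-,F-) satisfies B(-,H-) = B(-,G-). -/
open CategoryTheory

universe u

variable (Q : Type u) [SmallCategory Q] [∀ X Y : Q, CompleteLattice (X ⟶ Y)]

variable {Q}

section Quantaloid

namespace ObjMap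

variable {A B : QGraph Q} (F : ObjMap A B)

theorem cograph_comp_graph_le (hB : B.IsTR) (a : A.Obj) (b b' : B.Obj) :
    F.cograph b a ≫ F.graph a b' ≤ B.hom b b' := by
  simpa [cograph, graph] using hB.1 b (F.map a) b'

variable {F}

theorem IsSemiFun.hom_le_graph_comp_cograph (hF : F.IsSemiFun) (hB : B.IsTR) (a a' : A.Obj) :
    A.hom a a' ≤ F.graph a (F.map a) ≫ F.cograph (F.map a) a' := by
  refine (hF a a').trans_eq ?_
  simp only [cograph, graph, Category.assoc]
  rw [reassoc_of% hB.2.1 (F.map a) (F.map a')]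

theorem IsRSFun.hom_comp_graph_le (hF : F.IsRSFun) (a a' : A.Obj) (b : B.Obj) :
    A.hom a a' ≫ F.graph a' b ≤ F.graph a b :=
  (le_iSup (fun x => A.hom a x ≫ F.graph x b) a').trans_eq (hF.2.1 a b)

end ObjMap

namespace CCObj

variable {A : QGraph Q} (p : CCObj A)

theorem φ_comp_hom_le (a a' : A.Obj) : p.φ a ≫ A.hom a a' ≤ p.φ a' :=
  (le_iSup (fun x => p.φ x ≫ A.hom x a') a).trans_eq (p.φ_regl a')

theorem hom_comp_ψ_le (a a' : A.Obj) : A.hom a a' ≫ p.ψ a' ≤ p.ψ a :=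
  (le_iSup (fun x => A.hom a x ≫ p.ψ x) a').trans_eq (p.ψ_regr a)

end CCObj

variable [IsQuantaloid Q]

theorem comp_iSup {ι : Sort*} {X Y Z : Q} (f : X ⟶ Y) (g : ι → (Y ⟶ Z)) :
    f ≫ (⨆ i, g i) = ⨆ i, f ≫ g i := by
  rw [iSup, IsQuantaloid.comp_sSup, iSup_range]

theorem iSup_comp {ι : Sort*} {X Y Z : Q} (f : ι → (X ⟶ Y)) (g : Y ⟶ Z) :
    (⨆ i, f i) ≫ g = ⨆ i, f i ≫ g := by
  rw [iSup, IsQuantaloid.sSup_comp, iSup_range]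

theorem comp_le_comp {X Y Z : Q} {f f' : X ⟶ Y} {g g' : Y ⟶ Z} (hf : f ≤ f') (hg : g ≤ g') :
    f ≫ g ≤ f' ≫ g' := by
  have h₁ : f ≫ g ≤ f ≫ g' := by
    rw [← sup_eq_right.2 hg, ← sSup_pair, IsQuantaloid.comp_sSup, iSup_pair]
    exact le_sup_left
  have h₂ : f ≫ g' ≤ f' ≫ g' := by
    rw [← sup_eq_right.2 hf, ← sSup_pair, IsQuantaloid.sSup_comp, iSup_pair]
    exact le_sup_left
  exact h₁.trans h₂

theorem comp_comp_le {W X Y Z : Q} {f : W ⟶ X} {g : X ⟶ Y} {k : Y ⟶ Z} {l : X ⟶ Z}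
    (h : g ≫ k ≤ l) : (f ≫ g) ≫ k ≤ f ≫ l :=
  (Category.assoc f g k).le.trans (comp_le_comp le_rfl h)

theorem comp_comp_le' {W X Y Z : Q} {f : W ⟶ X} {g : X ⟶ Y} {k : Y ⟶ Z} {l : W ⟶ Y}
    (h : f ≫ g ≤ l) : f ≫ g ≫ k ≤ l ≫ k :=
  (Category.assoc f g k).ge.trans (comp_le_comp h le_rfl)

theorem comp_iSup_le_of_forall {ι : Sort*} {X Y Z : Q} {f : X ⟶ Y} {g : ι → (Y ⟶ Z)} {h : X ⟶ Z}
    (H : ∀ i, f ≫ g i ≤ h) : f ≫ (⨆ i, g i) ≤ h := by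
  rw [comp_iSup]
  exact iSup_le H

theorem iSup_comp_le_of_forall {ι : Sort*} {X Y Z : Q} {f : ι → (X ⟶ Y)} {g : Y ⟶ Z} {h : X ⟶ Z}
    (H : ∀ i, f i ≫ g ≤ h) : (⨆ i, f i) ≫ g ≤ h := by
  rw [iSup_comp]
  exact iSup_le H

namespace ObjMap

variable {A B : QGraph Q} (F : ObjMap A B)

theorem graph_comp_hom_le (hB : B.IsTR) (a : A.Obj) (b b' : B.Obj) :
    F.graph a b ≫ B.hom b b' ≤ F.graph a b' := by
  simp only [graph, Category.assoc]
  exact comp_le_comp le_rfl (hB.1 _ _ _)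

theorem hom_comp_cograph_le (hB : B.IsTR) (a : A.Obj) (b b' : B.Obj) :
    B.hom b b' ≫ F.cograph b' a ≤ F.cograph b a := by
  simp only [cograph, ← Category.assoc]
  exact comp_le_comp (hB.1 _ _ _) le_rfl

end ObjMap

namespace CCObj

variable {A : QGraph Q} (p q : CCObj A)

theorem cc_hom_comp_φ_le (a : A.Obj) : (QGraph.cc A).hom p q ≫ q.φ a ≤ p.φ a :=
  iSup_comp_le_of_forall fun x =>
    (comp_comp_le (q.counit x a)).trans (p.φ_comp_hom_le x a)

theorem ψ_comp_cc_hom_le (a : A.Obj) : p.ψ a ≫ (QGraph.cc A).hom p q ≤ q.ψ a :=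
  comp_iSup_le_of_forall fun x =>
    (comp_comp_le' (p.counit a x)).trans (q.hom_comp_ψ_le a x)

theorem cc_hom_self_comp_φ (a : A.Obj) : (QGraph.cc A).hom p p ≫ p.φ a = p.φ a :=
  le_antisymm (p.cc_hom_comp_φ_le p a)
    ((p.φ_regr a).symm.le.trans (comp_le_comp p.unit le_rfl))

theorem ψ_comp_cc_hom_self (a : A.Obj) : p.ψ a ≫ (QGraph.cc A).hom p p = p.ψ a :=
  le_antisymm (p.ψ_comp_cc_hom_le p a)
    ((p.ψ_regl a).symm.le.trans (comp_le_comp le_rfl p.unit))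

end CCObj

variable {A B : QGraph Q}

theorem QGraph.isTR_cc (A : QGraph Q) : (QGraph.cc A).IsTR := by
  refine ⟨fun (p q r : CCObj A) => ?_, fun (p q : CCObj A) => ?_, fun (p q : CCObj A) => ?_⟩
  · refine comp_iSup_le_of_forall fun a => ?_
    exact le_iSup_of_le a (comp_comp_le' (p.cc_hom_comp_φ_le q a))
  · refine (comp_iSup _ _).trans (iSup_congr fun a => ?_)
    exact (Category.assoc _ _ _).symm.trans (congrArg (· ≫ q.ψ a) (p.cc_hom_self_comp_φ a))
  · refine (iSup_comp _ _).trans (iSup_congr fun a => ?_)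
    exact (Category.assoc _ _ _).trans (congrArg (q.φ a ≫ ·) (p.ψ_comp_cc_hom_self a))

/-- The extension `A_cc ⇸ B` of the matrix `B(-,F-) : A ⇸ B`. -/
def ccGraph (F : ObjMap A B) : QMat (QGraph.cc A) B :=
  fun (p : CCObj A) b => ⨆ a, p.φ a ≫ F.graph a b

/-- The extension `B ⇸ A_cc` of the matrix `B(F-,-) : B ⇸ A`. -/
def ccCograph (F : ObjMap A B) : QMat B (QGraph.cc A) :=
  fun b (p : CCObj A) => ⨆ a, F.cograph b a ≫ p.ψ a

variable {F : ObjMap A B}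

theorem isRSDist_ccGraph (hB : B.IsTR) : IsRSDist (ccGraph F) := by
  refine ⟨fun (p : CCObj A) b' => ?_, fun (p : CCObj A) b => ?_⟩
  · refine le_antisymm (iSup_le fun b => iSup_comp_le_of_forall fun a => ?_) (iSup_le fun a => ?_)
    · exact le_iSup_of_le a (comp_comp_le (F.graph_comp_hom_le hB a b b'))
    · have h : F.graph a b' = F.graph a (F.map a) ≫ B.hom (F.map a) b' := by
        simp [ObjMap.graph, hB.2.1]
      refine le_iSup_of_le (F.map a) ?_
      exact (congrArg (p.φ a ≫ ·) h).le.trans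
        (comp_comp_le' (le_iSup (fun x => p.φ x ≫ F.graph x (F.map a)) a))
  · refine le_antisymm (iSup_le fun (q : CCObj A) => comp_iSup_le_of_forall fun a => ?_)
      (iSup_le fun a => ?_)
    · exact le_iSup_of_le a (comp_comp_le' (p.cc_hom_comp_φ_le q a))
    · refine le_iSup_of_le p ?_
      exact (congrArg (· ≫ F.graph a b) (p.cc_hom_self_comp_φ a)).ge.trans
        (comp_comp_le (le_iSup (fun x => p.φ x ≫ F.graph x b) a))

theorem isRSDist_ccCograph (hB : B.IsTR) : IsRSDist (ccCograph F) := by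
  refine ⟨fun b (p : CCObj A) => ?_, fun b' (p : CCObj A) => ?_⟩
  · refine le_antisymm (iSup_le fun (q : CCObj A) => iSup_comp_le_of_forall fun a => ?_)
      (iSup_le fun a => ?_)
    · exact le_iSup_of_le a (comp_comp_le (q.ψ_comp_cc_hom_le p a))
    · refine le_iSup_of_le p ?_
      exact (congrArg (F.cograph b a ≫ ·) (p.ψ_comp_cc_hom_self a)).ge.trans
        (comp_comp_le' (le_iSup (fun x => F.cograph b x ≫ p.ψ x) a))
  · refine le_antisymm (iSup_le fun b => comp_iSup_le_of_forall fun a => ?_) (iSup_le fun a => ?_)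
    · exact le_iSup_of_le a (comp_comp_le' (F.hom_comp_cograph_le hB a b' b))
    · have h : F.cograph b' a = B.hom b' (F.map a) ≫ F.cograph (F.map a) a := by
        simp [ObjMap.cograph, reassoc_of% hB.2.2]
      refine le_iSup_of_le (F.map a) ?_
      exact (congrArg (· ≫ p.ψ a) h).le.trans
        (comp_comp_le (le_iSup (fun x => F.cograph (F.map a) x ≫ p.ψ x) a))

theorem matAdj_ccGraph_ccCograph (hB : B.IsTR) (hF : F.IsRSFun) :
    MatAdj (ccGraph F) (ccCograph F) := by
  refine ⟨fun (p q : CCObj A) => iSup_le fun a => ?_,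
    fun b b' => iSup_le fun (p : CCObj A) => iSup_comp_le_of_forall fun a =>
      comp_iSup_le_of_forall fun a' => ?_⟩
  · refine (congrArg (· ≫ q.ψ a) (p.φ_regl a)).ge.trans
      (iSup_comp_le_of_forall fun a' => le_iSup_of_le (F.map a') ?_)
    calc (p.φ a' ≫ A.hom a' a) ≫ q.ψ a
        ≤ (p.φ a' ≫ F.graph a' (F.map a') ≫ F.cograph (F.map a') a) ≫ q.ψ a :=
          comp_le_comp (comp_le_comp le_rfl (hF.1.hom_le_graph_comp_cograph hB a' a)) le_rfl
      _ = (p.φ a' ≫ F.graph a' (F.map a')) ≫ F.cograph (F.map a') a ≫ q.ψ a := by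
          simp only [Category.assoc]
      _ ≤ (⨆ x, p.φ x ≫ F.graph x (F.map a')) ≫ ⨆ x, F.cograph (F.map a') x ≫ q.ψ x :=
          comp_le_comp (le_iSup (fun x => p.φ x ≫ F.graph x (F.map a')) a')
            (le_iSup (fun x => F.cograph (F.map a') x ≫ q.ψ x) a)
  · calc (F.cograph b a ≫ p.ψ a) ≫ p.φ a' ≫ F.graph a' b'
        = F.cograph b a ≫ (p.ψ a ≫ p.φ a') ≫ F.graph a' b' := by
          simp only [Category.assoc]
      _ ≤ F.cograph b a ≫ A.hom a a' ≫ F.graph a' b' :=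
          comp_le_comp le_rfl (comp_le_comp (p.counit a a') le_rfl)
      _ ≤ F.cograph b a ≫ F.graph a b' :=
          comp_le_comp le_rfl (hF.hom_comp_graph_le a a' b')
      _ ≤ B.hom b b' := F.cograph_comp_graph_le hB a b _

/-- A regular semifunctor on `A_cc` is determined by its restriction along `k_A`. -/
theorem ObjMap.IsRSFun.graph_eq_iSup_φ_comp_graph_kObj (hA : A.IsTR)
    {H : ObjMap (QGraph.cc A) B} (hH : H.IsRSFun) (p : CCObj A) (b : B.Obj) :
    H.graph p b = ⨆ a, p.φ a ≫ H.graph (kObj hA a) b := by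
  refine le_antisymm ?_ (iSup_le fun a => ?_)
  · refine (hH.2.1 p b).symm.le.trans (iSup_le fun (q : CCObj A) =>
      iSup_comp_le_of_forall fun a => ?_)
    refine le_iSup_of_le a (comp_comp_le ?_)
    have h : (QGraph.cc A).hom (kObj hA a) q = q.ψ a := q.ψ_regr a
    exact (congrArg (· ≫ H.graph q b) h).symm.le.trans (hH.hom_comp_graph_le (kObj hA a) q b)
  · have h : (QGraph.cc A).hom p (kObj hA a) = p.φ a := p.φ_regl a
    exact (congrArg (· ≫ H.graph (kObj hA a) b) h).symm.le.trans
      (hH.hom_comp_graph_le p (kObj hA a) b)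

end Quantaloid

/-- universal property of the Cauchy completion: any regular semifunctor
`F : A → B` into a Cauchy complete `B` factors through `k_A : A → A_cc` in an essentially
unique way. -/
theorem factorization_through_cc [IsQuantaloid Q] (A B : QGraph Q)
    (hA : A.IsTR) (hB : B.IsTR) (hBcc : CauchyComplete B)
    (F : ObjMap A B) (hF : F.IsRSFun) :
    ∃ G : ObjMap (QGraph.cc A) B, G.IsRSFun ∧
      (∀ a b, G.graph (kObj hA a) b = F.graph a b) ∧
      ∀ H : ObjMap (QGraph.cc A) B, H.IsRSFun →
        (∀ a b, H.graph (kObj hA a) b = F.graph a b) →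
        ∀ p b, H.graph p b = G.graph p b := by
  obtain ⟨G, hG, hΦ, -⟩ := hBcc (QGraph.cc A) (QGraph.isTR_cc A) (ccGraph F) (ccCograph F)
    (isRSDist_ccGraph hB) (isRSDist_ccCograph hB) (matAdj_ccGraph_ccCograph hB hF)
  refine ⟨G, hG, fun a b => (hΦ (kObj hA a) b).symm.trans (hF.2.1 a b), fun H hH hHF p b => ?_⟩
  refine (hH.graph_eq_iSup_φ_comp_graph_kObj hA p b).trans (Eq.trans ?_ (hΦ p b))
  exact iSup_congr fun a => congrArg (CCObj.φ p a ≫ ·) (hHF a b)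
end
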